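/- Let ν ∈ (0,1). For each nonzero φ ∈ C_c^∞(ℝ³, ℂ²) there is a unique λ(φ) ∈ (−1, +∞) such that λ(φ) ∫_{ℝ³} |φ(x)|² dx = ∫_{ℝ³} [ |((σ·∇)φ)(x)|²/(1 + ν/|x| + λ(φ)) + (1 − ν/|x|)|φ(x)|² ] dx, and the infimum of λ(φ) over all nonzero φ ∈ C_c^∞(ℝ³, ℂ²) equals √(1−ν²). -/

import Mathlib

open MeasureTheory Complex

noncomputable section

abbrev R3 := EuclideanSpace ℝ (Fin 3)
abbrev C2 := EuclideanSpace ℂ (Fin 2)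

/-- The `k`-th partial derivative of `φ : ℝ³ → ℂ²`. -/
noncomputable def pd (φ : R3 → C2) (k : Fin 3) (x : R3) : C2 :=
  fderiv ℝ φ x (EuclideanSpace.single k 1)

/-- `(σ·∇)φ = σ₁∂₁φ + σ₂∂₂φ + σ₃∂₃φ` with the Pauli matrices
`σ₁ = [[0,1],[1,0]]`, `σ₂ = [[0,-i],[i,0]]`, `σ₃ = [[1,0],[0,-1]]`. -/
noncomputable def sigmaGrad (φ : R3 → C2) (x : R3) : C2 :=
  (WithLp.equiv 2 (Fin 2 → ℂ)).symm
    ![pd φ 0 x 1 - Complex.I * pd φ 1 x 1 + pd φ 2 x 0,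
      pd φ 0 x 0 + Complex.I * pd φ 1 x 0 - pd φ 2 x 1]

/-- `φ ∈ C_c^∞(ℝ³, ℂ²)`. -/
def IsCc (φ : R3 → C2) : Prop := ContDiff ℝ (⊤ : ℕ∞) φ ∧ HasCompactSupport φ

/-- **Wirtinger's inequality** for a complex-valued function of mean zero on the circle. -/
theorem integral_norm_sq_le_of_periodic_of_integral_eq_zero {f f' : ℝ → ℂ}
    (hf : ∀ x, HasDerivAt f (f' x) x) (hf' : Continuous f')
    (hper : f (2 * Real.pi) = f 0) (hmean : ∫ x in (0 : ℝ)..(2 * Real.pi), f x = 0) :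
    ∫ x in (0 : ℝ)..(2 * Real.pi), ‖f x‖ ^ 2 ≤ ∫ x in (0 : ℝ)..(2 * Real.pi), ‖f' x‖ ^ 2 := by
  have hab : (0 : ℝ) < 2 * Real.pi := Real.two_pi_pos
  have hfc : Continuous f := continuous_iff_continuousAt.2 fun x => (hf x).continuousAt
  have memL : ∀ g : ℝ → ℂ, Continuous g →
      MemLp g 2 (volume.restrict (Set.Ioc 0 (2 * Real.pi))) := fun g hg =>
    ((memLp_two_iff_integrable_sq_norm hg.aestronglyMeasurable).2
      ((hg.norm.pow 2).integrableOn_Icc (a := 0) (b := 2 * Real.pi))).mono_measure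
      (Measure.restrict_mono Set.Ioc_subset_Icc_self le_rfl)
  have h1 := hasSum_sq_fourierCoeffOn hab (memL f hfc)
  have h2 := hasSum_sq_fourierCoeffOn hab (memL f' hf')
  have h3 : ∀ n : ℤ, ‖fourierCoeffOn hab f n‖ ^ 2 ≤ ‖fourierCoeffOn hab f' n‖ ^ 2 := by
    intro n
    rcases eq_or_ne n 0 with rfl | hn
    · rw [fourierCoeffOn_eq_integral]
      simp [hmean]
    · rw [fourierCoeffOn_of_hasDerivAt hab hn (fun x _ => hf x) (hf'.intervalIntegrable _ _)]
      rw [hper, sub_self, mul_zero, zero_sub]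
      gcongr
      have hn1 : (1 : ℝ) ≤ |(n : ℝ)| := by exact_mod_cast Int.one_le_abs hn
      have hpi := Real.pi_pos
      simp only [norm_mul, norm_neg, norm_div, norm_one, Complex.norm_I, Complex.norm_intCast]
      have e1 : ‖((2 * Real.pi : ℝ) : ℂ) - ((0 : ℝ) : ℂ)‖ = 2 * Real.pi := by
        rw [← Complex.ofReal_sub, Complex.norm_real, sub_zero, Real.norm_of_nonneg hab.le]
      have e2 : ‖(Real.pi : ℂ)‖ = Real.pi := by
        rw [Complex.norm_real, Real.norm_of_nonneg hpi.le]
      rw [e1, e2, ← mul_assoc]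
      refine mul_le_of_le_one_left (norm_nonneg _) ?_
      rw [Complex.norm_ofNat, div_mul_eq_mul_div, div_le_one (by positivity)]
      nlinarith
  have h4 := hasSum_le h3 h1 h2
  simp only [smul_eq_mul, sub_zero] at h4
  exact le_of_mul_le_mul_left h4 (by positivity)

/-- If `B` is a real bilinear form of norm at most one on `ℂ²`, then `∫ (|f'|² - B(f, f')) ≥ 0`
for every closed curve `f` in `ℂ²` of period `2π`. -/
theorem integral_norm_sq_sub_bilin_nonneg (B : C2 →L[ℝ] C2 →L[ℝ] ℝ)
    (hB : ∀ u v, |B u v| ≤ ‖u‖ * ‖v‖) {f f' : ℝ → C2}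
    (hf : ∀ x, HasDerivAt f (f' x) x) (hf' : Continuous f') (hper : f (2 * Real.pi) = f 0) :
    0 ≤ ∫ x in (0 : ℝ)..(2 * Real.pi), (‖f' x‖ ^ 2 - B (f x) (f' x)) := by
  have hfc : Continuous f := continuous_iff_continuousAt.2 fun x => (hf x).continuousAt
  have hpi := Real.pi_pos
  set m : C2 := (2 * Real.pi)⁻¹ • ∫ x in (0 : ℝ)..(2 * Real.pi), f x with hm
  have hcoord : ∀ i : Fin 2, ∫ x in (0 : ℝ)..(2 * Real.pi), ‖(f x - m) i‖ ^ 2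
      ≤ ∫ x in (0 : ℝ)..(2 * Real.pi), ‖f' x i‖ ^ 2 := by
    intro i
    set P : C2 →L[ℝ] ℂ := (EuclideanSpace.proj i : C2 →L[ℂ] ℂ).restrictScalars ℝ with hP
    have hPa : ∀ v : C2, P v = v i := fun v => rfl
    refine integral_norm_sq_le_of_periodic_of_integral_eq_zero
      (f := fun x => (f x - m) i) (f' := fun x => f' x i) ?_ ?_ ?_ ?_
    · intro x
      exact P.hasFDerivAt.comp_hasDerivAt x ((hf x).sub_const m)
    · exact P.continuous.comp hf'
    · simp [hper]
    · have h1 : ∫ x in (0 : ℝ)..(2 * Real.pi), P (f x - m)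
          = P (∫ x in (0 : ℝ)..(2 * Real.pi), (f x - m)) :=
        P.intervalIntegral_comp_comm ((hfc.sub continuous_const).intervalIntegrable _ _)
      have h2 : ∫ x in (0 : ℝ)..(2 * Real.pi), (f x - m) = 0 := by
        rw [intervalIntegral.integral_sub (hfc.intervalIntegrable _ _)
          (continuous_const.intervalIntegrable _ _), intervalIntegral.integral_const, hm,
          smul_smul, sub_zero, mul_inv_cancel₀ (by positivity), one_smul, sub_self]
      rw [h2, map_zero] at h1
      exact h1
  have hW : ∫ x in (0 : ℝ)..(2 * Real.pi), ‖f x - m‖ ^ 2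
      ≤ ∫ x in (0 : ℝ)..(2 * Real.pi), ‖f' x‖ ^ 2 := by
    simp only [EuclideanSpace.norm_sq_eq, Fin.sum_univ_two]
    have ci : ∀ i : Fin 2, Continuous fun x => ‖(f x - m) i‖ ^ 2 := fun i => by fun_prop
    have ci' : ∀ i : Fin 2, Continuous fun x => ‖(f' x) i‖ ^ 2 := fun i => by fun_prop
    rw [intervalIntegral.integral_add ((ci 0).intervalIntegrable _ _)
        ((ci 1).intervalIntegrable _ _),
      intervalIntegral.integral_add ((ci' 0).intervalIntegrable _ _)
        ((ci' 1).intervalIntegrable _ _)]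
    exact add_le_add (hcoord 0) (hcoord 1)
  have hBm : ∫ x in (0 : ℝ)..(2 * Real.pi), B m (f' x) = 0 := by
    rw [(B m).intervalIntegral_comp_comm (hf'.intervalIntegrable _ _),
      intervalIntegral.integral_eq_sub_of_hasDerivAt (fun x _ => hf x)
        (hf'.intervalIntegrable _ _), hper, sub_self, map_zero]
  have cB : Continuous fun x => B (f x) (f' x) := by fun_prop
  have cBm : Continuous fun x => B m (f' x) := by fun_prop
  have c1 : Continuous fun x => ‖f x - m‖ ^ 2 := by fun_prop
  have c2 : Continuous fun x => ‖f' x‖ ^ 2 := by fun_prop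
  have hle : ∫ x in (0 : ℝ)..(2 * Real.pi), (B (f x) (f' x) - B m (f' x))
      ≤ ∫ x in (0 : ℝ)..(2 * Real.pi), (2⁻¹ * ‖f x - m‖ ^ 2 + 2⁻¹ * ‖f' x‖ ^ 2) := by
    refine intervalIntegral.integral_mono_on (by positivity)
      ((cB.sub cBm).intervalIntegrable _ _)
      (((c1.const_mul _).add (c2.const_mul _)).intervalIntegrable _ _) fun x _ => ?_
    have h1 := (abs_le.1 (hB (f x - m) (f' x))).2
    rw [map_sub, sub_apply] at h1
    nlinarith [sq_nonneg (‖f x - m‖ - ‖f' x‖)]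
  rw [intervalIntegral.integral_sub (cB.intervalIntegrable _ _) (cBm.intervalIntegrable _ _),
    hBm, intervalIntegral.integral_add ((c1.const_mul _).intervalIntegrable _ _)
      ((c2.const_mul _).intervalIntegrable _ _), intervalIntegral.integral_const_mul,
    intervalIntegral.integral_const_mul] at hle
  rw [intervalIntegral.integral_sub (c2.intervalIntegrable _ _) (cB.intervalIntegrable _ _)]
  linarith

theorem integrableOn_inv_norm_ball (R : ℝ) :
    IntegrableOn (fun x : R3 => ‖x‖⁻¹) (Metric.ball 0 R) := by
  have := integrableOn_fun_norm_addHaar (volume : Measure R3) (f := fun y : ℝ => y⁻¹) (r := R)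
  rw [this, finrank_euclideanSpace_fin]
  have h : IntegrableOn (fun y : ℝ => y) (Set.Ioo 0 R) :=
    (continuous_id.integrableOn_Icc (a := 0) (b := R)).mono_set Set.Ioo_subset_Icc_self
  refine h.congr_fun (fun y hy => ?_) measurableSet_Ioo
  have hy0 : y ≠ 0 := hy.1.ne'
  simp only [smul_eq_mul]
  field_simp

theorem integrable_mul_of_abs_le_inv_norm {ρ q : R3 → ℝ} (hρ : Measurable ρ) {C : ℝ}
    (hC : ∀ x, |ρ x| ≤ C * ‖x‖⁻¹) (hq : Continuous q) (hqs : HasCompactSupport q) :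
    Integrable (fun x => ρ x * q x) := by
  obtain ⟨R, hR⟩ := hqs.isCompact.isBounded.subset_ball (0 : R3)
  obtain ⟨M, hM⟩ := hqs.exists_bound_of_continuous hq
  have hi : IntegrableOn (fun x => ρ x * q x) (Metric.ball 0 R) := by
    refine ((integrableOn_inv_norm_ball R).const_mul (C * M)).mono'
      (hρ.mul hq.measurable).aestronglyMeasurable (Filter.Eventually.of_forall fun x => ?_)
    rw [norm_mul, Real.norm_eq_abs]
    have h1 := hC x
    have h2 := hM x
    calc |ρ x| * ‖q x‖ ≤ (C * ‖x‖⁻¹) * M :=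
          mul_le_mul h1 h2 (norm_nonneg _) ((abs_nonneg _).trans h1)
      _ = C * M * ‖x‖⁻¹ := by ring
  rwa [integrableOn_iff_integrable_of_support_subset] at hi
  intro x hx
  refine hR (subset_tsupport _ ?_)
  rw [Function.mem_support] at hx ⊢
  exact fun h => hx (by rw [h, mul_zero])

/-- The generator of rotations in the `(x_j, x_k)` plane. -/
def rotGen (j k : Fin 3) (x : R3) : R3 :=
  x j • EuclideanSpace.single k (1 : ℝ) - x k • EuclideanSpace.single j (1 : ℝ)

/-- The rotation by the angle `θ` in the `(x_j, x_k)` plane. -/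
def rot (j k : Fin 3) (θ : ℝ) (x : R3) : R3 :=
  x + ((Real.cos θ - 1) * x j - Real.sin θ * x k) • EuclideanSpace.single j (1 : ℝ)
    + (Real.sin θ * x j + (Real.cos θ - 1) * x k) • EuclideanSpace.single k (1 : ℝ)

theorem rot_two_pi (j k : Fin 3) (x : R3) : rot j k (2 * Real.pi) x = rot j k 0 x := by
  simp [rot]

theorem norm_rot {j k : Fin 3} (hjk : j ≠ k) (θ : ℝ) (x : R3) : ‖rot j k θ x‖ = ‖x‖ := by
  have h := Real.sin_sq_add_cos_sq θ
  rw [← sq_eq_sq₀ (norm_nonneg _) (norm_nonneg _), EuclideanSpace.real_norm_sq_eq,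
    EuclideanSpace.real_norm_sq_eq, Fin.sum_univ_three, Fin.sum_univ_three]
  fin_cases j <;> fin_cases k <;> first | exact absurd rfl hjk | skip
  all_goals
    simp [rot]
    first
    | linear_combination (x 0 ^ 2 + x 1 ^ 2) * h
    | linear_combination (x 0 ^ 2 + x 2 ^ 2) * h
    | linear_combination (x 1 ^ 2 + x 2 ^ 2) * h

/-- `rot j k θ` as a linear isometry. -/
def rotLI {j k : Fin 3} (hjk : j ≠ k) (θ : ℝ) : R3 →ₗᵢ[ℝ] R3 where
  toFun := rot j k θ
  map_add' x y := by simp only [rot, PiLp.add_apply]; module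
  map_smul' c x := by simp only [rot, PiLp.smul_apply, smul_eq_mul, RingHom.id_apply]; module
  norm_map' := norm_rot hjk θ

theorem integral_comp_rot {j k : Fin 3} (hjk : j ≠ k) (θ : ℝ) (F : R3 → ℝ) :
    ∫ x, F (rot j k θ x) = ∫ x, F x :=
  ((rotLI hjk θ).toLinearIsometryEquiv rfl).measurePreserving.integral_comp
    ((rotLI hjk θ).toLinearIsometryEquiv rfl).toHomeomorph.measurableEmbedding F

theorem hasDerivAt_rot {j k : Fin 3} (hjk : j ≠ k) (x : R3) (θ : ℝ) :
    HasDerivAt (fun t => rot j k t x) (rotGen j k (rot j k θ x)) θ := by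
  have h1 : HasDerivAt (fun t => rot j k t x)
      ((-Real.sin θ * x j - Real.cos θ * x k) • EuclideanSpace.single j (1 : ℝ)
        + (Real.cos θ * x j + -Real.sin θ * x k) • EuclideanSpace.single k (1 : ℝ)) θ := by
    have ha := (((Real.hasDerivAt_cos θ).sub_const 1).mul_const (x j)).sub
      ((Real.hasDerivAt_sin θ).mul_const (x k))
    have hb := ((Real.hasDerivAt_sin θ).mul_const (x j)).add
      (((Real.hasDerivAt_cos θ).sub_const 1).mul_const (x k))
    have := ((ha.smul_const (EuclideanSpace.single j (1 : ℝ))).const_add x).add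
      (hb.smul_const (EuclideanSpace.single k (1 : ℝ)))
    exact this
  convert h1 using 1
  have ej : (rot j k θ x) j = Real.cos θ * x j - Real.sin θ * x k := by
    simp [rot, hjk]
    ring
  have ek : (rot j k θ x) k = Real.sin θ * x j + Real.cos θ * x k := by
    simp [rot, hjk.symm]
    ring
  rw [rotGen, ej, ek]
  module

theorem continuous_rotGen (j k : Fin 3) : Continuous (rotGen j k) := by
  unfold rotGen; fun_prop

theorem continuous_rot (j k : Fin 3) : Continuous fun p : ℝ × R3 => rot j k p.1 p.2 := by
  unfold rot; fun_prop

/-- Averaging `integral_norm_sq_sub_bilin_nonneg` over all circles around a coordinate axis. -/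
theorem integral_weight_mul_rotGen_nonneg {j k : Fin 3} (hjk : j ≠ k) (B : C2 →L[ℝ] C2 →L[ℝ] ℝ)
    (hB : ∀ u v, |B u v| ≤ ‖u‖ * ‖v‖) {w : ℝ → ℝ} (hw : Measurable w) (hw0 : ∀ r, 0 ≤ r → 0 ≤ w r)
    {C : ℝ} (hC : ∀ r, 0 ≤ r → w r ≤ C * r⁻¹) {φ : R3 → C2} (hφ : ContDiff ℝ 1 φ)
    (hs : HasCompactSupport φ) :
    0 ≤ ∫ x, w ‖x‖ * (‖fderiv ℝ φ x (rotGen j k x)‖ ^ 2 - B (φ x) (fderiv ℝ φ x (rotGen j k x))) := by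
  have hd : Continuous fun x => fderiv ℝ φ x (rotGen j k x) :=
    (hφ.continuous_fderiv one_ne_zero).clm_apply (continuous_rotGen j k)
  set q : R3 → ℝ := fun x =>
    ‖fderiv ℝ φ x (rotGen j k x)‖ ^ 2 - B (φ x) (fderiv ℝ φ x (rotGen j k x)) with hqdef
  have hφc := hφ.continuous
  have hq : Continuous q := by fun_prop
  have hqs : HasCompactSupport q := by
    refine (hs.fderiv ℝ).mono fun x hx => ?_
    rw [Function.mem_support] at hx ⊢
    intro h
    exact hx (by simp [hqdef, h])
  obtain ⟨R, hR⟩ := hqs.isCompact.isBounded.subset_ball (0 : R3)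
  obtain ⟨M, hM⟩ := hqs.exists_bound_of_continuous hq
  have hpi := Real.pi_pos
  have hwm : Measurable fun x : R3 => w ‖x‖ := hw.comp measurable_norm
  have hzero : ∀ x : R3, x ∉ Metric.ball (0 : R3) R → q x = 0 := fun x hx => by
    by_contra h
    exact hx (hR (subset_tsupport _ h))
  have hint : Integrable (fun p : ℝ × R3 => w ‖p.2‖ * q (rot j k p.1 p.2))
      ((volume.restrict (Set.Ioc 0 (2 * Real.pi))).prod volume) := by
    have hb : Integrable (fun x : R3 =>
        (Metric.ball (0 : R3) R).indicator (fun x => C * M * ‖x‖⁻¹) x) :=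
      (integrable_indicator_iff Metric.isOpen_ball.measurableSet).2
        ((integrableOn_inv_norm_ball R).const_mul (C * M))
    refine (hb.comp_snd (volume.restrict (Set.Ioc 0 (2 * Real.pi)))).mono'
      ((hwm.comp measurable_snd).mul
        (hq.comp (continuous_rot j k)).measurable).aestronglyMeasurable
      (Filter.Eventually.of_forall fun p => ?_)
    by_cases hp : p.2 ∈ Metric.ball (0 : R3) R
    · rw [Set.indicator_of_mem hp, norm_mul, Real.norm_eq_abs,
        abs_of_nonneg (hw0 _ (norm_nonneg _))]
      have h1 := hC ‖p.2‖ (norm_nonneg _)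
      calc w ‖p.2‖ * ‖q (rot j k p.1 p.2)‖ ≤ (C * ‖p.2‖⁻¹) * M :=
            mul_le_mul h1 (hM _) (norm_nonneg _) ((hw0 _ (norm_nonneg _)).trans h1)
        _ = C * M * ‖p.2‖⁻¹ := by ring
    · rw [Set.indicator_of_notMem hp, hzero _ (by simpa [norm_rot hjk] using hp)]
      simp
  have hswap := integral_integral_swap
    (f := fun (θ : ℝ) (x : R3) => w ‖x‖ * q (rot j k θ x)) hint
  have hrot : ∀ θ : ℝ, ∫ x, w ‖x‖ * q (rot j k θ x) = ∫ x, w ‖x‖ * q x := fun θ => by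
    rw [← integral_comp_rot hjk θ fun x => w ‖x‖ * q x]
    simp only [norm_rot hjk]
  simp only [hrot] at hswap
  rw [integral_const, smul_eq_mul] at hswap
  have hpos : 0 ≤ ∫ x : R3, ∫ θ in Set.Ioc 0 (2 * Real.pi), w ‖x‖ * q (rot j k θ x) := by
    refine integral_nonneg fun x => ?_
    simp only [Pi.zero_apply]
    rw [integral_const_mul, ← intervalIntegral.integral_of_le (by positivity)]
    refine mul_nonneg (hw0 _ (norm_nonneg _)) ?_
    refine integral_norm_sq_sub_bilin_nonneg B hB (f := fun θ => φ (rot j k θ x))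
      (f' := fun θ => fderiv ℝ φ (rot j k θ x) (rotGen j k (rot j k θ x))) ?_ ?_ ?_
    · intro θ
      exact ((hφ.differentiable one_ne_zero) _).hasFDerivAt.comp_hasDerivAt θ
        (hasDerivAt_rot hjk x θ)
    · exact hd.comp ((continuous_rot j k).comp (by fun_prop : Continuous fun θ : ℝ => (θ, x)))
    · simp only [rot_two_pi]
  rw [← hswap] at hpos
  refine nonneg_of_mul_nonneg_right hpos ?_
  simp [hpi]

theorem hasFDerivAt_norm_R3 {x : R3} (hx : x ≠ 0) :
    HasFDerivAt (fun y : R3 => ‖y‖) (‖x‖⁻¹ • innerSL ℝ x) x := by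
  have h0 : ‖x‖ ^ 2 ≠ 0 := by simpa using hx
  have h1 := (hasStrictFDerivAt_norm_sq x).hasFDerivAt.sqrt h0
  simp only [Real.sqrt_sq (norm_nonneg _)] at h1
  refine h1.congr_fderiv (ContinuousLinearMap.ext fun v => ?_)
  simp
  field_simp

theorem contDiff_fderiv_const {φ : R3 → C2} (hφ : ContDiff ℝ 2 φ) (v : R3) :
    ContDiff ℝ 1 fun x => fderiv ℝ φ x v :=
  (hφ.fderiv_right (m := 1) (by norm_num)).clm_apply contDiff_const

theorem integral_weight_fderiv_bilin {K : NNReal} {F : R3 → ℝ} (hF : LipschitzWith K F)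
    {w : R3 → ℝ} (hF' : ∀ x ≠ 0, HasFDerivAt F (w x • innerSL ℝ x) x)
    (B : C2 →L[ℝ] C2 →L[ℝ] ℝ) {φ : R3 → C2} (hφ : ContDiff ℝ 2 φ) (hs : HasCompactSupport φ)
    (m l : Fin 3) :
    ∫ x, F x * (B (pd φ m x) (pd φ l x) + B (φ x)
      (fderiv ℝ (fderiv ℝ φ) x (EuclideanSpace.single m 1) (EuclideanSpace.single l 1)))
      = -∫ x, w x * (x m * B (φ x) (pd φ l x)) := by
  set g : R3 → ℝ := fun x => B (φ x) (pd φ l x) with hg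
  have hpd := contDiff_fderiv_const hφ (EuclideanSpace.single l 1)
  have hφ1 : ContDiff ℝ 1 φ := hφ.of_le (by norm_num)
  have hgC : ContDiff ℝ 1 g := (B.contDiff.comp hφ1).clm_apply hpd
  have hgs : HasCompactSupport g := hs.mono fun x hx => by
    rw [Function.mem_support] at hx ⊢
    exact fun h => hx (by simp [hg, h])
  obtain ⟨D, hD⟩ := ContDiff.lipschitzWith_of_hasCompactSupport hgs hgC one_ne_zero
  have key := LipschitzWith.integral_lineDeriv_mul_eq (μ := volume) hF hD hgs
    (EuclideanSpace.single m 1)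
  have hR : ∀ x, lineDeriv ℝ g x (-EuclideanSpace.single m 1) * F x
      = -(F x * (B (pd φ m x) (pd φ l x) + B (φ x)
      (fderiv ℝ (fderiv ℝ φ) x (EuclideanSpace.single m 1) (EuclideanSpace.single l 1)))) := by
    intro x
    rw [((hgC.differentiable one_ne_zero) x).lineDeriv_eq_fderiv]
    have d1 : HasFDerivAt (fun x => B (φ x)) (B.comp (fderiv ℝ φ x)) x :=
      B.hasFDerivAt.comp x ((hφ1.differentiable one_ne_zero) x).hasFDerivAt
    have d2 : HasFDerivAt (fderiv ℝ φ) (fderiv ℝ (fderiv ℝ φ) x) x :=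
      (((hφ.fderiv_right (m := 1) (by norm_num)).differentiable one_ne_zero) x).hasFDerivAt
    have d3 := d2.clm_apply (hasFDerivAt_const (EuclideanSpace.single l (1 : ℝ)) x)
    have d4 := d1.clm_apply d3
    have d5 : HasFDerivAt g _ x := d4
    rw [d5.fderiv]
    simp [pd]
    ring
  have hL : ∀ᵐ x : R3, lineDeriv ℝ F x (EuclideanSpace.single m 1) * g x
      = w x * (x m * B (φ x) (pd φ l x)) := by
    filter_upwards [Measure.ae_ne volume (0 : R3)] with x hx
    rw [(hF' x hx).differentiableAt.lineDeriv_eq_fderiv, (hF' x hx).fderiv]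
    simp only [hg, smul_apply, innerSL_apply_apply, smul_eq_mul,
      EuclideanSpace.inner_single_right, one_mul, conj_trivial]
    ring
  rw [integral_congr_ae hL] at key
  simp only [hR, integral_neg] at key
  linarith

theorem integral_weight_mul_bilin {K : NNReal} {F : R3 → ℝ} (hF : LipschitzWith K F)
    {w : R3 → ℝ} (hw : Measurable w) {C : ℝ} (hC : ∀ x, |w x| ≤ C * ‖x‖⁻¹)
    (hF' : ∀ x ≠ 0, HasFDerivAt F (w x • innerSL ℝ x) x)
    (B : C2 →L[ℝ] C2 →L[ℝ] ℝ) (hB : ∀ u v, B u v = -B v u)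
    {φ : R3 → C2} (hφ : ContDiff ℝ 2 φ) (hs : HasCompactSupport φ) (j k : Fin 3) :
    ∫ x, F x * (2 * B (pd φ j x) (pd φ k x))
      = -∫ x, w x * B (φ x) (fderiv ℝ φ x (rotGen j k x)) := by
  have h1 := integral_weight_fderiv_bilin hF hF' B hφ hs j k
  have h2 := integral_weight_fderiv_bilin hF hF' B hφ hs k j
  have hφ1 : ContDiff ℝ 1 φ := hφ.of_le (by norm_num)
  have cφ := hφ.continuous
  have cpd : ∀ l, Continuous (pd φ l) := fun l => (contDiff_fderiv_const hφ _).continuous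
  have cdd : Continuous (fderiv ℝ (fderiv ℝ φ)) :=
    (hφ.fderiv_right (m := 1) (by norm_num)).continuous_fderiv one_ne_zero
  have i1 : ∀ m l : Fin 3, Integrable fun x => F x * (B (pd φ m x) (pd φ l x) + B (φ x)
      (fderiv ℝ (fderiv ℝ φ) x (EuclideanSpace.single m 1) (EuclideanSpace.single l 1))) := by
    intro m l
    refine Continuous.integrable_of_hasCompactSupport ?_ ?_
    · have := hF.continuous
      have := cpd m
      have := cpd l
      fun_prop
    · refine HasCompactSupport.mul_left (HasCompactSupport.add ?_ ?_)
      · refine ((hs.fderiv_apply ℝ (EuclideanSpace.single l (1 : ℝ)))).mono fun x hx => ?_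
        rw [Function.mem_support] at hx ⊢
        exact fun h => hx (by simp [pd, h])
      · refine hs.mono fun x hx => ?_
        rw [Function.mem_support] at hx ⊢
        exact fun h => hx (by simp [h])
  have i2 : ∀ m l : Fin 3, Integrable fun x => w x * (x m * B (φ x) (pd φ l x)) := by
    intro m l
    refine integrable_mul_of_abs_le_inv_norm hw hC ?_ ?_
    · have := cpd l
      fun_prop
    · refine hs.mono fun x hx => ?_
      rw [Function.mem_support] at hx ⊢
      exact fun h => hx (by simp [h])
  have h3 := integral_sub (i1 j k) (i1 k j)
  have h4 := integral_sub (i2 j k) (i2 k j)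
  rw [h1, h2] at h3
  have e1 : ∀ x, F x * (B (pd φ j x) (pd φ k x) + B (φ x)
      (fderiv ℝ (fderiv ℝ φ) x (EuclideanSpace.single j 1) (EuclideanSpace.single k 1)))
      - F x * (B (pd φ k x) (pd φ j x) + B (φ x)
      (fderiv ℝ (fderiv ℝ φ) x (EuclideanSpace.single k 1) (EuclideanSpace.single j 1)))
      = F x * (2 * B (pd φ j x) (pd φ k x)) := by
    intro x
    have hsym : IsSymmSndFDerivAt ℝ φ x :=
      hφ.contDiffAt.isSymmSndFDerivAt (by simp)
    rw [hsym (EuclideanSpace.single k 1) (EuclideanSpace.single j 1), hB (pd φ k x) (pd φ j x)]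
    ring
  have e2 : ∀ x, w x * (x j * B (φ x) (pd φ k x)) - w x * (x k * B (φ x) (pd φ j x))
      = w x * B (φ x) (fderiv ℝ φ x (rotGen j k x)) := by
    intro x
    simp only [rotGen, map_sub, map_smul, smul_eq_mul, pd]
    ring
  simp only [e1] at h3
  simp only [e2] at h4
  linarith

/-- The Euler identity `∫ |x|⁻¹ (x·∇g + 2g) = 0` on `ℝ³`. -/
theorem integral_inv_norm_mul_euler {g : R3 → ℝ} (hg : ContDiff ℝ 1 g) (hs : HasCompactSupport g) :
    ∫ x : R3, ‖x‖⁻¹ * (fderiv ℝ g x x + 2 * g x) = 0 := by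
  have hgc := hg.continuous
  have hEc : Continuous fun x => fderiv ℝ g x x :=
    (hg.continuous_fderiv one_ne_zero).clm_apply continuous_id
  have hEs : HasCompactSupport fun x => fderiv ℝ g x x :=
    (hs.fderiv ℝ).mono fun x hx => by
      rw [Function.mem_support] at hx ⊢
      exact fun h => hx (by simp [h])
  obtain ⟨R, hR⟩ := hEs.isCompact.isBounded.subset_ball (0 : R3)
  obtain ⟨M, hM⟩ := hEs.exists_bound_of_continuous hEc
  have hM0 : 0 ≤ M := (norm_nonneg _).trans (hM 0)
  have hmeas : Measurable fun x : R3 => ‖x‖⁻¹ := measurable_norm.inv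
  have hinv : ∀ x : R3, |‖x‖⁻¹| ≤ 1 * ‖x‖⁻¹ := fun x => by
    rw [one_mul, abs_of_nonneg (by positivity)]
  have ig := integrable_mul_of_abs_le_inv_norm hmeas hinv hgc hs
  have iE := integrable_mul_of_abs_le_inv_norm hmeas hinv hEc hEs
  have hscale : ∀ t : ℝ, 0 < t →
      ∫ x : R3, ‖x‖⁻¹ * g (t • x) = (t ^ 2)⁻¹ * ∫ x : R3, ‖x‖⁻¹ * g x := by
    intro t ht
    have h := Measure.integral_comp_smul (volume : Measure R3) (fun x => ‖x‖⁻¹ * g x) t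
    rw [finrank_euclideanSpace_fin, abs_of_nonneg (by positivity)] at h
    simp only [norm_smul, Real.norm_of_nonneg ht.le, mul_inv, mul_assoc, smul_eq_mul] at h
    rw [integral_const_mul] at h
    field_simp at h ⊢
    exact h
  have hder : HasDerivAt (fun t : ℝ => ∫ x : R3, ‖x‖⁻¹ * g (t • x))
      (∫ x : R3, ‖x‖⁻¹ * fderiv ℝ g ((1 : ℝ) • x) x) 1 := by
    refine (hasDerivAt_integral_of_dominated_loc_of_deriv_le
      (F := fun (t : ℝ) (x : R3) => ‖x‖⁻¹ * g (t • x))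
      (F' := fun (t : ℝ) (x : R3) => ‖x‖⁻¹ * fderiv ℝ g (t • x) x)
      (s := Set.Ioi (1 / 2 : ℝ))
      (bound := (Metric.ball (0 : R3) (2 * R)).indicator fun x => 2 * M * ‖x‖⁻¹)
      (Ioi_mem_nhds (by norm_num)) ?_ ?_ ?_ ?_ ?_ ?_).2
    · refine Filter.Eventually.of_forall fun t => ?_
      exact (hmeas.mul (hgc.comp (continuous_const_smul t)).measurable).aestronglyMeasurable
    · simpa using ig
    · simpa using iE.aestronglyMeasurable
    · refine Filter.Eventually.of_forall fun x t ht => ?_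
      have ht0 : (0 : ℝ) < t := lt_trans (by norm_num) ht
      have ht2 : t⁻¹ ≤ 2 := by
        rw [inv_le_comm₀ ht0 two_pos]; exact (by norm_num : (2 : ℝ)⁻¹ = 1 / 2).le.trans (le_of_lt ht)
      have e : fderiv ℝ g (t • x) x = t⁻¹ * fderiv ℝ g (t • x) (t • x) := by
        rw [map_smul, smul_eq_mul, inv_mul_cancel_left₀ ht0.ne']
      by_cases hx : x ∈ Metric.ball (0 : R3) (2 * R)
      · rw [Set.indicator_of_mem hx, norm_mul, e, norm_mul, Real.norm_of_nonneg (by positivity),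
          Real.norm_of_nonneg (by positivity)]
        have := hM (t • x)
        calc ‖x‖⁻¹ * (t⁻¹ * ‖fderiv ℝ g (t • x) (t • x)‖) ≤ ‖x‖⁻¹ * (2 * M) := by gcongr
          _ = 2 * M * ‖x‖⁻¹ := by ring
      · rw [Set.indicator_of_notMem hx]
        have hz : fderiv ℝ g (t • x) (t • x) = 0 := by
          by_contra h
          have h1 := hR (subset_tsupport _ (Function.mem_support.2 h))
          rw [mem_ball_zero_iff, norm_smul, Real.norm_of_nonneg ht0.le] at h1
          refine hx (mem_ball_zero_iff.2 ?_)
          have ht' : 1 / 2 < t := ht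
          nlinarith [norm_nonneg x]
        rw [e, hz]
        simp
    · exact (integrable_indicator_iff Metric.isOpen_ball.measurableSet).2
        ((integrableOn_inv_norm_ball (2 * R)).const_mul (2 * M))
    · refine Filter.Eventually.of_forall fun x t _ => ?_
      have h1 : HasDerivAt (fun t : ℝ => t • x) x t := by
        simpa using (hasDerivAt_id t).smul_const x
      exact (((hg.differentiable one_ne_zero) _).hasFDerivAt.comp_hasDerivAt t h1).const_mul _
  have hder2 : HasDerivAt (fun t : ℝ => ∫ x : R3, ‖x‖⁻¹ * g (t • x))
      (-2 * ∫ x : R3, ‖x‖⁻¹ * g x) 1 := by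
    have h1 : HasDerivAt (fun t : ℝ => (t ^ 2)⁻¹ * ∫ x : R3, ‖x‖⁻¹ * g x)
        (-2 * ∫ x : R3, ‖x‖⁻¹ * g x) 1 := by
      have := ((hasDerivAt_pow 2 (1 : ℝ)).inv (by norm_num)).mul_const (∫ x : R3, ‖x‖⁻¹ * g x)
      exact this.congr_deriv (by norm_num)
    refine h1.congr_of_eventuallyEq ?_
    filter_upwards [Ioi_mem_nhds (zero_lt_one' ℝ)] with t ht
    exact hscale t ht
  have hu := hder.unique hder2
  simp only [one_smul] at hu
  have e : ∀ x : R3, ‖x‖⁻¹ * (fderiv ℝ g x x + 2 * g x)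
      = ‖x‖⁻¹ * fderiv ℝ g x x + 2 * (‖x‖⁻¹ * g x) := fun x => by ring
  simp only [e]
  rw [integral_add iE (ig.const_mul 2), integral_const_mul, hu]
  ring

theorem norm_sq_C2 (u : C2) : ‖u‖ ^ 2 = ‖u 0‖ ^ 2 + ‖u 1‖ ^ 2 := by
  rw [EuclideanSpace.norm_sq_eq, Fin.sum_univ_two]

theorem abs_le_norm_mul_norm_C2 (u v : C2) {t : ℝ}
    (h : |t| ≤ ‖u 0‖ * ‖v 0‖ + ‖u 1‖ * ‖v 1‖ ∨ |t| ≤ ‖u 0‖ * ‖v 1‖ + ‖u 1‖ * ‖v 0‖) :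
    |t| ≤ ‖u‖ * ‖v‖ := by
  refine abs_le_of_sq_le_sq' ?_ (by positivity) |> abs_le.2
  rw [mul_pow, norm_sq_C2, norm_sq_C2, ← sq_abs]
  rcases h with h | h
  · nlinarith [sq_nonneg (‖u 0‖ * ‖v 1‖ - ‖u 1‖ * ‖v 0‖), pow_le_pow_left₀ (abs_nonneg t) h 2]
  · nlinarith [sq_nonneg (‖u 0‖ * ‖v 0‖ - ‖u 1‖ * ‖v 1‖), pow_le_pow_left₀ (abs_nonneg t) h 2]

theorem abs_pauli₁₂_le (u v : C2) :
    |(u 0 * starRingEnd ℂ (v 0)).im - (u 1 * starRingEnd ℂ (v 1)).im| ≤ ‖u‖ * ‖v‖ := by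
  refine abs_le_norm_mul_norm_C2 u v (Or.inl ?_)
  refine (abs_sub _ _).trans (add_le_add ?_ ?_) <;>
    exact (Complex.abs_im_le_norm _).trans (by simp)

/-- The form `Re ⟨u, σ₁σ₂ v⟩`, up to sign. -/
def pauliForm₁₂ : C2 →L[ℝ] C2 →L[ℝ] ℝ :=
  LinearMap.mkContinuous₂ (LinearMap.mk₂ ℝ
    (fun u v : C2 => (u 0 * starRingEnd ℂ (v 0)).im - (u 1 * starRingEnd ℂ (v 1)).im)
    (fun _ _ _ => by simp; ring) (fun _ _ _ => by simp; ring)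
    (fun _ _ _ => by simp; ring) (fun _ _ _ => by simp; ring)) 1 fun u v => by
      rw [one_mul]; exact abs_pauli₁₂_le u v

theorem pauliForm₁₂_apply (u v : C2) : pauliForm₁₂ u v =
    (u 0 * starRingEnd ℂ (v 0)).im - (u 1 * starRingEnd ℂ (v 1)).im := rfl

theorem pauliForm₁₂_antisymm (u v : C2) : pauliForm₁₂ u v = -pauliForm₁₂ v u := by
  simp [pauliForm₁₂_apply]; ring

theorem abs_pauli₁₃_le (u v : C2) :
    |(u 1 * starRingEnd ℂ (v 0)).re - (u 0 * starRingEnd ℂ (v 1)).re| ≤ ‖u‖ * ‖v‖ := by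
  refine abs_le_norm_mul_norm_C2 u v (Or.inr ?_)
  rw [add_comm]
  refine (abs_sub _ _).trans (add_le_add ?_ ?_) <;>
    exact (Complex.abs_re_le_norm _).trans (by simp)

/-- The form `Re ⟨u, σ₁σ₃ v⟩`, up to sign. -/
def pauliForm₁₃ : C2 →L[ℝ] C2 →L[ℝ] ℝ :=
  LinearMap.mkContinuous₂ (LinearMap.mk₂ ℝ
    (fun u v : C2 => (u 1 * starRingEnd ℂ (v 0)).re - (u 0 * starRingEnd ℂ (v 1)).re)
    (fun _ _ _ => by simp; ring) (fun _ _ _ => by simp; ring)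
    (fun _ _ _ => by simp; ring) (fun _ _ _ => by simp; ring)) 1 fun u v => by
      rw [one_mul]; exact abs_pauli₁₃_le u v

theorem pauliForm₁₃_apply (u v : C2) : pauliForm₁₃ u v =
    (u 1 * starRingEnd ℂ (v 0)).re - (u 0 * starRingEnd ℂ (v 1)).re := rfl

theorem pauliForm₁₃_antisymm (u v : C2) : pauliForm₁₃ u v = -pauliForm₁₃ v u := by
  simp [pauliForm₁₃_apply]; ring

theorem abs_pauli₂₃_le (u v : C2) :
    |(u 1 * starRingEnd ℂ (v 0)).im + (u 0 * starRingEnd ℂ (v 1)).im| ≤ ‖u‖ * ‖v‖ := by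
  refine abs_le_norm_mul_norm_C2 u v (Or.inr ?_)
  rw [add_comm (‖u 0‖ * ‖v 1‖)]
  refine (abs_add_le _ _).trans (add_le_add ?_ ?_) <;>
    exact (Complex.abs_im_le_norm _).trans (by simp)

/-- The form `Re ⟨u, σ₂σ₃ v⟩`, up to sign. -/
def pauliForm₂₃ : C2 →L[ℝ] C2 →L[ℝ] ℝ :=
  LinearMap.mkContinuous₂ (LinearMap.mk₂ ℝ
    (fun u v : C2 => (u 1 * starRingEnd ℂ (v 0)).im + (u 0 * starRingEnd ℂ (v 1)).im)
    (fun _ _ _ => by simp; ring) (fun _ _ _ => by simp; ring)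
    (fun _ _ _ => by simp; ring) (fun _ _ _ => by simp; ring)) 1 fun u v => by
      rw [one_mul]; exact abs_pauli₂₃_le u v

theorem pauliForm₂₃_apply (u v : C2) : pauliForm₂₃ u v =
    (u 1 * starRingEnd ℂ (v 0)).im + (u 0 * starRingEnd ℂ (v 1)).im := rfl

theorem pauliForm₂₃_antisymm (u v : C2) : pauliForm₂₃ u v = -pauliForm₂₃ v u := by
  simp [pauliForm₂₃_apply]; ring

theorem norm_sq_sigmaGrad (φ : R3 → C2) (x : R3) :
    ‖sigmaGrad φ x‖ ^ 2 = ‖pd φ 0 x‖ ^ 2 + ‖pd φ 1 x‖ ^ 2 + ‖pd φ 2 x‖ ^ 2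
      + 2 * pauliForm₁₂ (pd φ 0 x) (pd φ 1 x) + 2 * pauliForm₁₃ (pd φ 0 x) (pd φ 2 x)
      + 2 * pauliForm₂₃ (pd φ 1 x) (pd φ 2 x) := by
  simp only [pauliForm₁₂_apply, pauliForm₁₃_apply, pauliForm₂₃_apply, norm_sq_C2, sigmaGrad,
    Complex.sq_norm, Complex.normSq_apply]
  simp
  ring

theorem fderiv_self_eq (φ : R3 → C2) (x : R3) :
    fderiv ℝ φ x x = x 0 • pd φ 0 x + x 1 • pd φ 1 x + x 2 • pd φ 2 x := by
  have hx : x = x 0 • EuclideanSpace.single 0 (1 : ℝ) + x 1 • EuclideanSpace.single 1 (1 : ℝ)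
      + x 2 • EuclideanSpace.single 2 (1 : ℝ) := by
    ext i
    fin_cases i <;> simp
  have h := congrArg (fderiv ℝ φ x) hx
  rwa [map_add, map_add, map_smul, map_smul, map_smul] at h

theorem fderiv_rotGen_eq (φ : R3 → C2) (j k : Fin 3) (x : R3) :
    fderiv ℝ φ x (rotGen j k x) = x j • pd φ k x - x k • pd φ j x := by
  simp only [rotGen, map_sub, map_smul, pd]

/-- Splitting of the gradient into its radial and angular components. -/
theorem norm_sq_mul_norm_sq_grad (φ : R3 → C2) (x : R3) :
    ‖x‖ ^ 2 * (‖pd φ 0 x‖ ^ 2 + ‖pd φ 1 x‖ ^ 2 + ‖pd φ 2 x‖ ^ 2) =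
      ‖fderiv ℝ φ x x‖ ^ 2 + ‖fderiv ℝ φ x (rotGen 0 1 x)‖ ^ 2
        + ‖fderiv ℝ φ x (rotGen 0 2 x)‖ ^ 2 + ‖fderiv ℝ φ x (rotGen 1 2 x)‖ ^ 2 := by
  rw [EuclideanSpace.real_norm_sq_eq, Fin.sum_univ_three]
  simp only [fderiv_self_eq, fderiv_rotGen_eq, norm_sq_C2, Complex.sq_norm, Complex.normSq_apply]
  simp
  ring

section Weight

variable {a ν : ℝ}

theorem lipschitzWith_weight (ha : 0 < a) (hν : 0 < ν) :
    LipschitzWith (Real.toNNReal ν⁻¹) fun x : R3 => ‖x‖ / (a * ‖x‖ + ν) := by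
  refine LipschitzWith.of_dist_le_mul fun x y => ?_
  rw [Real.coe_toNNReal _ (by positivity), Real.dist_eq]
  have hx := norm_nonneg x
  have hy := norm_nonneg y
  have hdx : ν ≤ a * ‖x‖ + ν := by nlinarith
  have hdy : ν ≤ a * ‖y‖ + ν := by nlinarith
  have hpos : 0 < (a * ‖x‖ + ν) * (a * ‖y‖ + ν) := by positivity
  have e : ‖x‖ / (a * ‖x‖ + ν) - ‖y‖ / (a * ‖y‖ + ν)
      = ν * (‖x‖ - ‖y‖) / ((a * ‖x‖ + ν) * (a * ‖y‖ + ν)) := by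
    field_simp
    ring
  rw [e, abs_div, abs_mul, abs_of_pos hν, abs_of_pos hpos, div_le_iff₀ hpos]
  have h1 : |‖x‖ - ‖y‖| ≤ dist x y := by rw [dist_eq_norm]; exact abs_norm_sub_norm_le x y
  have h2 : ν * ν ≤ (a * ‖x‖ + ν) * (a * ‖y‖ + ν) := mul_le_mul hdx hdy hν.le (by positivity)
  calc ν * |‖x‖ - ‖y‖| ≤ ν * dist x y := by gcongr
    _ = ν⁻¹ * dist x y * (ν * ν) := by field_simp
    _ ≤ _ := by gcongr

theorem hasFDerivAt_weight (ha : 0 < a) (hν : 0 < ν) {x : R3} (hx : x ≠ 0) :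
    HasFDerivAt (fun x : R3 => ‖x‖ / (a * ‖x‖ + ν))
      ((ν / (‖x‖ * (a * ‖x‖ + ν) ^ 2)) • innerSL ℝ x) x := by
  have hr : 0 < ‖x‖ := norm_pos_iff.2 hx
  have hd : 0 < a * ‖x‖ + ν := by positivity
  have h1 : HasDerivAt (fun r : ℝ => r / (a * r + ν)) (ν / (a * ‖x‖ + ν) ^ 2) ‖x‖ := by
    have h := (hasDerivAt_id ‖x‖).div (((hasDerivAt_id ‖x‖).const_mul a).add_const ν) hd.ne'
    refine h.congr_deriv ?_
    simp
    ring
  have h2 := h1.comp_hasFDerivAt x (hasFDerivAt_norm_R3 hx)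
  refine h2.congr_fderiv ?_
  rw [smul_smul]
  congr 1
  field_simp

variable {φ : R3 → C2}

/-- The contribution of one coordinate plane to the angular part of the energy is nonnegative. -/
theorem angular_part (ha : 0 < a) (hν : 0 < ν) (hφ : ContDiff ℝ 2 φ) (hs : HasCompactSupport φ)
    {j k : Fin 3} (hjk : j ≠ k) (B : C2 →L[ℝ] C2 →L[ℝ] ℝ) (hB : ∀ u v, B u v = -B v u)
    (hB1 : ∀ u v, |B u v| ≤ ‖u‖ * ‖v‖) :
    Integrable (fun x => ‖x‖ / (a * ‖x‖ + ν) * (2 * B (pd φ j x) (pd φ k x))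
      + ν / (‖x‖ * (a * ‖x‖ + ν) ^ 2) * ‖fderiv ℝ φ x (rotGen j k x)‖ ^ 2) ∧
    0 ≤ ∫ x, (‖x‖ / (a * ‖x‖ + ν) * (2 * B (pd φ j x) (pd φ k x))
      + ν / (‖x‖ * (a * ‖x‖ + ν) ^ 2) * ‖fderiv ℝ φ x (rotGen j k x)‖ ^ 2) := by
  have hφ1 : ContDiff ℝ 1 φ := hφ.of_le (by norm_num)
  have hφc := hφ.continuous
  have cpd : ∀ l, Continuous (pd φ l) := fun l => (contDiff_fderiv_const hφ _).continuous
  have spd : ∀ l, HasCompactSupport (pd φ l) := fun l => hs.fderiv_apply ℝ _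
  have cD : Continuous fun x => fderiv ℝ φ x (rotGen j k x) :=
    (hφ1.continuous_fderiv one_ne_zero).clm_apply (continuous_rotGen j k)
  have sD : HasCompactSupport fun x => fderiv ℝ φ x (rotGen j k x) :=
    (hs.fderiv ℝ).mono fun x hx => by
      rw [Function.mem_support] at hx ⊢
      exact fun h => hx (by simp [h])
  have hw : Measurable fun r : ℝ => ν / (r * (a * r + ν) ^ 2) := by fun_prop
  have hw0 : ∀ r : ℝ, 0 ≤ r → 0 ≤ ν / (r * (a * r + ν) ^ 2) := fun r hr => by positivity
  have hwC : ∀ r : ℝ, 0 ≤ r → ν / (r * (a * r + ν) ^ 2) ≤ ν⁻¹ * r⁻¹ := fun r hr => by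
    rcases hr.eq_or_lt with rfl | hr
    · simp
    · rw [div_le_iff₀ (by positivity)]
      have h1 : ν ^ 2 ≤ (a * r + ν) ^ 2 := by gcongr; nlinarith
      calc ν = ν⁻¹ * ν ^ 2 := by field_simp
        _ ≤ ν⁻¹ * (a * r + ν) ^ 2 := by gcongr
        _ = _ := by field_simp
  have hwC' : ∀ x : R3, |ν / (‖x‖ * (a * ‖x‖ + ν) ^ 2)| ≤ ν⁻¹ * ‖x‖⁻¹ := fun x => by
    rw [abs_of_nonneg (hw0 _ (norm_nonneg x))]
    exact hwC _ (norm_nonneg x)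
  have hwm : Measurable fun x : R3 => ν / (‖x‖ * (a * ‖x‖ + ν) ^ 2) := hw.comp measurable_norm
  have key := integral_weight_mul_bilin (lipschitzWith_weight ha hν) hwm hwC'
    (fun x hx => hasFDerivAt_weight ha hν hx) B hB hφ hs j k
  have key2 := integral_weight_mul_rotGen_nonneg hjk B hB1 hw hw0 hwC hφ1 hs
  have i1 : Integrable fun x => ‖x‖ / (a * ‖x‖ + ν) * (2 * B (pd φ j x) (pd φ k x)) := by
    refine Continuous.integrable_of_hasCompactSupport ?_ ?_
    · have := (lipschitzWith_weight ha hν).continuous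
      have := cpd j
      have := cpd k
      fun_prop
    · refine (spd j).mono fun x hx => ?_
      rw [Function.mem_support] at hx ⊢
      exact fun h => hx (by simp [h])
  have i2 : Integrable fun x => ν / (‖x‖ * (a * ‖x‖ + ν) ^ 2)
      * ‖fderiv ℝ φ x (rotGen j k x)‖ ^ 2 := by
    refine integrable_mul_of_abs_le_inv_norm hwm hwC' (by fun_prop) ?_
    refine sD.mono fun x hx => ?_
    rw [Function.mem_support] at hx ⊢
    exact fun h => hx (by simp [h])
  have i3 : Integrable fun x => ν / (‖x‖ * (a * ‖x‖ + ν) ^ 2)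
      * B (φ x) (fderiv ℝ φ x (rotGen j k x)) := by
    refine integrable_mul_of_abs_le_inv_norm hwm hwC' (by fun_prop) ?_
    refine sD.mono fun x hx => ?_
    rw [Function.mem_support] at hx ⊢
    exact fun h => hx (by simp [h])
  refine ⟨i1.add i2, ?_⟩
  simp only [mul_sub] at key2
  rw [integral_sub i2 i3] at key2
  rw [integral_add i1 i2, key]
  linarith

end Weight

variable {φ : R3 → C2} {ν : ℝ}

theorem continuous_sigmaGrad (hφ : ContDiff ℝ 1 φ) : Continuous (sigmaGrad φ) := by
  have cpd : ∀ l, Continuous (pd φ l) := fun l =>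
    (hφ.continuous_fderiv one_ne_zero).clm_apply continuous_const
  have h0 := cpd 0
  have h1 := cpd 1
  have h2 := cpd 2
  refine (PiLp.continuous_toLp 2 _).comp (continuous_pi fun i => ?_)
  fin_cases i
  · simp only [Fin.zero_eta, Matrix.cons_val_zero]; fun_prop
  · simp only [Fin.mk_one, Matrix.cons_val_one]; fun_prop

theorem hasCompactSupport_sigmaGrad (hs : HasCompactSupport φ) :
    HasCompactSupport (sigmaGrad φ) := by
  refine (hs.fderiv ℝ).mono fun x hx => ?_
  rw [Function.mem_support] at hx ⊢
  refine fun h => hx ?_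
  ext i
  fin_cases i <;> simp [sigmaGrad, pd, h]

theorem integrable_norm_sq_sigmaGrad (hφ : ContDiff ℝ 1 φ) (hs : HasCompactSupport φ) :
    Integrable fun x => ‖sigmaGrad φ x‖ ^ 2 := by
  refine ((continuous_sigmaGrad hφ).norm.pow 2).integrable_of_hasCompactSupport ?_
  refine (hasCompactSupport_sigmaGrad hs).mono fun x hx => ?_
  rw [Function.mem_support] at hx ⊢
  exact fun h => hx (by simp [h])

theorem kinetic_le (hν : 0 < ν) {l m : ℝ} (hl : -1 < l) (hlm : l ≤ m) (x : R3) :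
    ‖sigmaGrad φ x‖ ^ 2 / (1 + ν / ‖x‖ + m) ≤ ‖sigmaGrad φ x‖ ^ 2 / (1 + ν / ‖x‖ + l) := by
  have h : 0 ≤ ν / ‖x‖ := by positivity
  exact div_le_div_of_nonneg_left (by positivity) (by linarith) (by linarith)

theorem kinetic_le_const (hν : 0 < ν) {l : ℝ} (hl : -1 < l) (x : R3) :
    ‖‖sigmaGrad φ x‖ ^ 2 / (1 + ν / ‖x‖ + l)‖ ≤ ‖sigmaGrad φ x‖ ^ 2 / (1 + l) := by
  have h : 0 ≤ ν / ‖x‖ := by positivity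
  rw [Real.norm_of_nonneg (div_nonneg (by positivity) (by linarith))]
  exact div_le_div_of_nonneg_left (by positivity) (by linarith) (by linarith)

theorem aestronglyMeasurable_kinetic (hφ : ContDiff ℝ 1 φ) (l : ℝ) :
    AEStronglyMeasurable fun x => ‖sigmaGrad φ x‖ ^ 2 / (1 + ν / ‖x‖ + l) := by
  have := (continuous_sigmaGrad hφ).measurable
  exact Measurable.aestronglyMeasurable (by fun_prop)

theorem integrable_kinetic (hν : 0 < ν) (hφ : ContDiff ℝ 1 φ) (hs : HasCompactSupport φ)
    {l : ℝ} (hl : -1 < l) :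
    Integrable fun x => ‖sigmaGrad φ x‖ ^ 2 / (1 + ν / ‖x‖ + l) :=
  ((integrable_norm_sq_sigmaGrad hφ hs).div_const (1 + l)).mono'
    (aestronglyMeasurable_kinetic hφ l) (Filter.Eventually.of_forall (kinetic_le_const hν hl))

theorem integrable_norm_sq (hφ : Continuous φ) (hs : HasCompactSupport φ) :
    Integrable fun x => ‖φ x‖ ^ 2 := by
  refine (hφ.norm.pow 2).integrable_of_hasCompactSupport ?_
  refine hs.mono fun x hx => ?_
  rw [Function.mem_support] at hx ⊢
  exact fun h => hx (by simp [h])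

theorem integrable_inv_norm_mul_norm_sq (hφ : Continuous φ) (hs : HasCompactSupport φ) :
    Integrable fun x => ‖x‖⁻¹ * ‖φ x‖ ^ 2 := by
  refine integrable_mul_of_abs_le_inv_norm measurable_norm.inv (C := 1)
    (fun x => by rw [one_mul, abs_of_nonneg (by positivity)]) (hφ.norm.pow 2) ?_
  refine hs.mono fun x hx => ?_
  rw [Function.mem_support] at hx ⊢
  exact fun h => hx (by simp [h])

theorem integrable_potential (ν : ℝ) (hφ : Continuous φ) (hs : HasCompactSupport φ) :
    Integrable fun x => (1 - ν / ‖x‖) * ‖φ x‖ ^ 2 := by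
  have := (integrable_norm_sq hφ hs).sub ((integrable_inv_norm_mul_norm_sq hφ hs).const_mul ν)
  refine this.congr (Filter.Eventually.of_forall fun x => ?_)
  simp only [Pi.sub_apply]
  ring

theorem euler_norm_sq (hφ : ContDiff ℝ 1 φ) (hs : HasCompactSupport φ) :
    Integrable (fun x => ‖x‖⁻¹ * (2 * inner ℝ (φ x) (fderiv ℝ φ x x) + 2 * ‖φ x‖ ^ 2)) ∧
    ∫ x, ‖x‖⁻¹ * (2 * inner ℝ (φ x) (fderiv ℝ φ x x) + 2 * ‖φ x‖ ^ 2) = 0 := by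
  have hs2 : HasCompactSupport fun x => ‖φ x‖ ^ 2 := hs.mono fun x hx => by
    rw [Function.mem_support] at hx ⊢
    exact fun h => hx (by simp [h])
  have hC : ContDiff ℝ 1 fun x => ‖φ x‖ ^ 2 := hφ.norm_sq ℝ
  have e : ∀ x, fderiv ℝ (fun x => ‖φ x‖ ^ 2) x x = 2 * inner ℝ (φ x) (fderiv ℝ φ x x) := by
    intro x
    rw [(((hφ.differentiable one_ne_zero) x).hasFDerivAt.norm_sq).fderiv]
    simp
  constructor
  · have hφc := hφ.continuous
    have cE : Continuous fun x => fderiv ℝ φ x x :=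
      (hφ.continuous_fderiv one_ne_zero).clm_apply continuous_id
    refine integrable_mul_of_abs_le_inv_norm measurable_norm.inv (C := 1)
      (fun x => by rw [one_mul, abs_of_nonneg (by positivity)]) (by fun_prop) ?_
    refine hs.mono fun x hx => ?_
    rw [Function.mem_support] at hx ⊢
    exact fun h => hx (by simp [h])
  · simpa only [e] using integral_inv_norm_mul_euler hC hs2

/-- The Hardy-type inequality for the Dirac operator with Coulomb potential. -/
theorem coulomb_hardy (hν : ν ∈ Set.Ioo (0 : ℝ) 1) (hφ : ContDiff ℝ 2 φ)
    (hs : HasCompactSupport φ) :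
    √(1 - ν ^ 2) * ∫ x : R3, ‖φ x‖ ^ 2 ≤
      ∫ x : R3, (‖sigmaGrad φ x‖ ^ 2 / (1 + ν / ‖x‖ + √(1 - ν ^ 2))
        + (1 - ν / ‖x‖) * ‖φ x‖ ^ 2) := by
  obtain ⟨hν0, hν1⟩ := hν
  set γ := √(1 - ν ^ 2) with hγ
  have hγ0 : 0 ≤ γ := Real.sqrt_nonneg _
  have hγ2 : γ ^ 2 = 1 - ν ^ 2 := Real.sq_sqrt (by nlinarith)
  have hφ1 : ContDiff ℝ 1 φ := hφ.of_le (by norm_num)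
  have ha : 0 < 1 + γ := by linarith
  set k := ν / (1 + γ) with hk
  have hka : k * (1 + γ) = ν := by rw [hk]; field_simp
  have hkν : k * ν = 1 - γ := by
    rw [hk]; field_simp; linear_combination hγ2
  obtain ⟨i1, p1⟩ := angular_part ha hν0 hφ hs (j := 0) (k := 1) (by decide) pauliForm₁₂
    pauliForm₁₂_antisymm abs_pauli₁₂_le
  obtain ⟨i2, p2⟩ := angular_part ha hν0 hφ hs (j := 0) (k := 2) (by decide) pauliForm₁₃
    pauliForm₁₃_antisymm abs_pauli₁₃_le
  obtain ⟨i3, p3⟩ := angular_part ha hν0 hφ hs (j := 1) (k := 2) (by decide) pauliForm₂₃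
    pauliForm₂₃_antisymm abs_pauli₂₃_le
  obtain ⟨i4, p4⟩ := euler_norm_sq hφ1 hs
  have iN := integrable_norm_sq hφ.continuous hs
  have iT := (integrable_kinetic hν0 hφ1 hs (by linarith : -1 < γ)).add
    (integrable_potential ν hφ.continuous hs)
  have hmono := integral_mono_ae (((i1.add i2).add i3).sub (i4.const_mul k))
    (iT.sub (iN.const_mul γ)) ?_
  · have e1 := integral_sub ((i1.add i2).add i3) (i4.const_mul k)
    have e2 := integral_add (i1.add i2) i3
    have e3 := integral_add i1 i2
    have e4 := integral_sub iT (iN.const_mul γ)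
    rw [integral_const_mul] at e1 e4
    simp only [Pi.add_apply, Pi.sub_apply] at hmono e1 e2 e3 e4
    rw [e4, e1, e2, e3, p4] at hmono
    linarith
  · filter_upwards [Measure.ae_ne volume (0 : R3)] with x hx
    simp only [Pi.add_apply, Pi.sub_apply]
    have hr : 0 < ‖x‖ := norm_pos_iff.2 hx
    have hd : 0 < (1 + γ) * ‖x‖ + ν := by positivity
    have hw : ‖sigmaGrad φ x‖ ^ 2 / (1 + ν / ‖x‖ + γ)
        = ‖x‖ / ((1 + γ) * ‖x‖ + ν) * ‖sigmaGrad φ x‖ ^ 2 := by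
      field_simp
      ring_nf
    rw [hw, norm_sq_sigmaGrad]
    have hgrad := norm_sq_mul_norm_sq_grad φ x
    set G := ‖pd φ 0 x‖ ^ 2 + ‖pd φ 1 x‖ ^ 2 + ‖pd φ 2 x‖ ^ 2
    set E := fderiv ℝ φ x x
    set D1 := ‖fderiv ℝ φ x (rotGen 0 1 x)‖ ^ 2 with hD1
    set D2 := ‖fderiv ℝ φ x (rotGen 0 2 x)‖ ^ 2 with hD2
    set D3 := ‖fderiv ℝ φ x (rotGen 1 2 x)‖ ^ 2 with hD3
    have hD : 0 ≤ D1 + D2 + D3 := by positivity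
    set r := ‖x‖
    set d := (1 + γ) * r + ν with hdd
    have hsq : 0 ≤ ‖E + (k * d) • φ x‖ ^ 2 := by positivity
    rw [norm_add_sq_real, inner_smul_right, norm_smul, Real.norm_eq_abs, mul_pow, sq_abs,
      real_inner_comm] at hsq
    set p := inner ℝ (φ x) E
    set N := ‖φ x‖ ^ 2
    have hE : 0 ≤ (r * d)⁻¹ * (‖E‖ ^ 2 + 2 * (k * d * p) + (k * d) ^ 2 * N) :=
      mul_nonneg (by positivity) hsq
    have hw2 : ν / (r * d ^ 2) * (D1 + D2 + D3) ≤ (r * d)⁻¹ * (D1 + D2 + D3) := by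
      refine mul_le_mul_of_nonneg_right ?_ hD
      rw [div_le_iff₀ (by positivity)]
      have : (r * d)⁻¹ * (r * d ^ 2) = d := by field_simp
      rw [this, hdd]
      nlinarith
    have hG : r / d * G = (r * d)⁻¹ * (‖E‖ ^ 2 + D1 + D2 + D3) := by
      rw [← hgrad]; field_simp
    have hcross : (r * d)⁻¹ * (2 * (k * d * p)) = k * r⁻¹ * (2 * p) := by field_simp
    have hpot : (r * d)⁻¹ * ((k * d) ^ 2 * N) = (1 - γ) * N + k * k * ν * r⁻¹ * N := by
      have : (r * d)⁻¹ * ((k * d) ^ 2 * N) = k * k * (d * r⁻¹) * N := by field_simp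
      have hdr : d * r⁻¹ = (1 + γ) + ν * r⁻¹ := by rw [hdd]; field_simp
      rw [this, hdr]
      linear_combination (k * N) * hka + N * hkν
    have hlast : k * k * ν + ν = 2 * k := by
      rw [mul_assoc, hkν]; linear_combination -hka
    have hν' : ν / r = ν * r⁻¹ := div_eq_mul_inv _ _
    rw [hν']
    have hl2 : (k * k * ν + ν) * (r⁻¹ * N) = 2 * k * (r⁻¹ * N) := by rw [hlast]
    linarith

/-- The spinor field with radial first component `h` and vanishing second component. -/
def radialSpinor (h : ℝ → ℝ) (x : R3) : C2 := h ‖x‖ • EuclideanSpace.single 0 (1 : ℂ)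

section Radial

variable {h : ℝ → ℝ} {a b : ℝ}

theorem norm_radialSpinor (x : R3) : ‖radialSpinor h x‖ = |h ‖x‖| := by
  simp [radialSpinor, norm_smul]

theorem isCc_radialSpinor (hh : ∀ r, 0 < r → ContDiffAt ℝ (⊤ : ℕ∞) h r) (ha : 0 < a)
    (h0 : ∀ r, 0 ≤ r → r < a → h r = 0) (hb : ∀ r, b < r → h r = 0) :
    IsCc (radialSpinor h) := by
  constructor
  · rw [contDiff_iff_contDiffAt]
    intro x
    rcases eq_or_ne x 0 with rfl | hx
    · have : radialSpinor h =ᶠ[nhds 0] fun _ => 0 := by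
        filter_upwards [Metric.ball_mem_nhds (0 : R3) ha] with y hy
        rw [mem_ball_zero_iff] at hy
        simp [radialSpinor, h0 _ (norm_nonneg y) hy]
      exact contDiffAt_const.congr_of_eventuallyEq this
    · exact ((hh _ (norm_pos_iff.2 hx)).comp x (contDiffAt_norm ℝ hx)).smul contDiffAt_const
  · refine HasCompactSupport.intro (isCompact_closedBall (0 : R3) b) fun x hx => ?_
    rw [mem_closedBall_zero_iff, not_le] at hx
    simp [radialSpinor, hb _ hx]

theorem hasFDerivAt_radialSpinor {h' : ℝ} {x : R3} (hx : x ≠ 0) (hh : HasDerivAt h h' ‖x‖) :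
    HasFDerivAt (radialSpinor h)
      ((h' • ‖x‖⁻¹ • innerSL ℝ x).smulRight (EuclideanSpace.single 0 (1 : ℂ) : C2)) x :=
  (hh.comp_hasFDerivAt x (hasFDerivAt_norm_R3 hx)).smul_const _

theorem norm_sq_sigmaGrad_radialSpinor {h' : ℝ} {x : R3} (hx : x ≠ 0)
    (hh : HasDerivAt h h' ‖x‖) : ‖sigmaGrad (radialSpinor h) x‖ ^ 2 = h' ^ 2 := by
  have hp : ∀ k, pd (radialSpinor h) k x
      = (h' * (‖x‖⁻¹ * x k)) • (EuclideanSpace.single 0 (1 : ℂ) : C2) := by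
    intro k
    rw [pd, (hasFDerivAt_radialSpinor hx hh).fderiv]
    simp [EuclideanSpace.inner_single_right]
  have hr : ‖x‖ ^ 2 = x 0 ^ 2 + x 1 ^ 2 + x 2 ^ 2 := by
    rw [EuclideanSpace.real_norm_sq_eq, Fin.sum_univ_three]
  have hr0 : ‖x‖ ≠ 0 := norm_ne_zero_iff.2 hx
  rw [norm_sq_sigmaGrad, hp, hp, hp]
  simp only [norm_smul, mul_pow, pauliForm₁₂_apply, pauliForm₁₃_apply, pauliForm₂₃_apply, Real.norm_eq_abs, sq_abs]
  simp
  have : (‖x‖ ^ 2)⁻¹ * ‖x‖ ^ 2 = 1 := inv_mul_cancel₀ (pow_ne_zero 2 hr0)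
  linear_combination h' ^ 2 * this - h' ^ 2 * (‖x‖ ^ 2)⁻¹ * hr

theorem inner_fderiv_radialSpinor {h' : ℝ} {x : R3} (hx : x ≠ 0)
    (hh : HasDerivAt h h' ‖x‖) :
    inner ℝ (radialSpinor h x) (fderiv ℝ (radialSpinor h) x x) = ‖x‖ * (h ‖x‖ * h') := by
  have hr0 : ‖x‖ ≠ 0 := norm_ne_zero_iff.2 hx
  rw [(hasFDerivAt_radialSpinor hx hh).fderiv, radialSpinor]
  simp [inner_smul_left, inner_smul_right]
  field_simp

end Radial

/-- The radial profile of the Coulomb ground state. -/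
def groundProfile (γ ν r : ℝ) : ℝ := r ^ (γ - 1) * Real.exp (-ν * r)

theorem hasDerivAt_groundProfile (γ ν : ℝ) {r : ℝ} (hr : 0 < r) :
    HasDerivAt (groundProfile γ ν) (((γ - 1) / r - ν) * groundProfile γ ν r) r := by
  have h1 := Real.hasDerivAt_rpow_const (p := γ - 1) (Or.inl hr.ne')
  have h2 := ((hasDerivAt_id r).const_mul (-ν)).exp
  refine (h1.mul h2).congr_deriv ?_
  rw [Real.rpow_sub_one hr.ne' (γ - 1), groundProfile]
  simp
  ring

theorem integrable_groundProfile {γ ν : ℝ} (hγ : 0 < γ) (hν : 0 < ν) :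
    Integrable fun x : R3 => groundProfile γ ν ‖x‖ ^ 2 / ‖x‖ := by
  refine (integrable_fun_norm_addHaar (volume : Measure R3)
    (f := fun r => groundProfile γ ν r ^ 2 / r)).2 ?_
  have := integrableOn_rpow_mul_exp_neg_mul_rpow (p := 1) (s := 2 * γ - 1) (b := 2 * ν)
    (by linarith) one_pos (by linarith)
  refine this.congr_fun (fun r hr => ?_) measurableSet_Ioi
  have hr : 0 < r := hr
  simp only [groundProfile, finrank_euclideanSpace, Fintype.card_fin, Real.rpow_one, smul_eq_mul]
  rw [mul_pow, ← Real.exp_nat_mul, ← Real.rpow_mul_natCast hr.le,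
    show (2 * γ - 1 : ℝ) = (γ - 1) * (2 : ℕ) + 1 by push_cast; ring, Real.rpow_add_one hr.ne']
  have : -(2 * ν) * r = (2 : ℕ) * (-ν * r) := by push_cast; ring
  rw [this]
  field_simp

/-- The ground state profile, truncated on a logarithmic scale. -/
def trialProfile (ζ : ℝ → ℝ) (γ ν δ r : ℝ) : ℝ := ζ (δ * Real.log r) * groundProfile γ ν r

section Trial

variable {ζ : ℝ → ℝ} {γ ν δ : ℝ}

theorem isCc_trial (hζ : ContDiff ℝ (⊤ : ℕ∞) ζ) (hζ2 : ∀ t, 2 ≤ |t| → ζ t = 0)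
    (hγ1 : γ ≠ 1) (hδ : 0 < δ) : IsCc (radialSpinor (trialProfile ζ γ ν δ)) := by
  refine isCc_radialSpinor (a := Real.exp (-(2 / δ))) (b := Real.exp (2 / δ)) ?_
    (Real.exp_pos _) ?_ ?_
  · intro r hr
    have h1 : ContDiffAt ℝ (⊤ : ℕ∞) (fun r => ζ (δ * Real.log r)) r :=
      hζ.contDiffAt.comp r (contDiffAt_const.mul (Real.contDiffAt_log.2 hr.ne'))
    have h2 : ContDiffAt ℝ (⊤ : ℕ∞) (fun r : ℝ => r ^ (γ - 1)) r :=
      Real.contDiffAt_rpow_const_of_ne hr.ne'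
    have h3 : ContDiffAt ℝ (⊤ : ℕ∞) (fun r : ℝ => Real.exp (-ν * r)) r := by fun_prop
    exact h1.mul (h2.mul h3)
  · intro r hr hr2
    rcases hr.eq_or_lt with rfl | hr
    · simp [trialProfile, groundProfile, Real.zero_rpow (sub_ne_zero.2 hγ1)]
    · have := (Real.log_lt_iff_lt_exp hr).2 hr2
      have h2 : δ * Real.log r < -2 := by
        have := mul_lt_mul_of_pos_left this hδ
        rwa [mul_neg, mul_div_cancel₀ _ hδ.ne'] at this
      rw [trialProfile, hζ2 _ (le_abs.2 (Or.inr (by linarith))), zero_mul]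
  · intro r hr
    have := (Real.lt_log_iff_exp_lt ((Real.exp_pos _).trans hr)).2 hr
    have h2 : 2 < δ * Real.log r := by
      have := mul_lt_mul_of_pos_left this hδ
      rwa [mul_div_cancel₀ _ hδ.ne'] at this
    rw [trialProfile, hζ2 _ (le_abs.2 (Or.inl (by linarith))), zero_mul]

theorem hasDerivAt_trialProfile (hζ : Differentiable ℝ ζ) {r : ℝ} (hr : 0 < r) :
    HasDerivAt (trialProfile ζ γ ν δ)
      (δ / r * deriv ζ (δ * Real.log r) * groundProfile γ ν r
        + ((γ - 1) / r - ν) * trialProfile ζ γ ν δ r) r := by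
  have h1 := (hζ (δ * Real.log r)).hasDerivAt.comp r ((Real.hasDerivAt_log hr.ne').const_mul δ)
  refine (h1.mul (hasDerivAt_groundProfile γ ν hr)).congr_deriv ?_
  simp only [Function.comp, trialProfile]
  ring

/-- The truncated ground state almost saturates the Hardy-type inequality. -/
theorem trial_energy_le (hν : 0 < ν) (hγ : 0 < γ) (hγ1 : γ < 1) (hγν : γ ^ 2 = 1 - ν ^ 2)
    (hζ : ContDiff ℝ (⊤ : ℕ∞) ζ) (hζ2 : ∀ t, 2 ≤ |t| → ζ t = 0) {C : ℝ}
    (hC : ∀ t, |deriv ζ t| ≤ C) (hδ : 0 < δ) {φ : R3 → C2}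
    (hφ : φ = radialSpinor (trialProfile ζ γ ν δ)) :
    ∫ x : R3, (‖sigmaGrad φ x‖ ^ 2 / (1 + ν / ‖x‖ + γ) + (1 - ν / ‖x‖) * ‖φ x‖ ^ 2)
      ≤ γ * (∫ x : R3, ‖φ x‖ ^ 2)
        + δ ^ 2 * (C ^ 2 / ν * ∫ x : R3, groundProfile γ ν ‖x‖ ^ 2 / ‖x‖) := by
  obtain ⟨hφc, hs⟩ : IsCc φ := hφ ▸ isCc_trial hζ hζ2 hγ1.ne hδ
  have hφ1 : ContDiff ℝ 1 φ := hφc.of_le (by exact_mod_cast le_top)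
  obtain ⟨i4, p4⟩ := euler_norm_sq hφ1 hs
  have iN := integrable_norm_sq hφ1.continuous hs
  have iT := (integrable_kinetic hν hφ1 hs (by linarith : -1 < γ)).add
    (integrable_potential ν hφ1.continuous hs)
  have iG := integrable_groundProfile hγ hν
  set k := ν / (1 + γ) with hk
  have ha : 0 < 1 + γ := by linarith
  have hka : k * (1 + γ) = ν := by rw [hk]; field_simp
  have hkν : k * ν = 1 - γ := by
    rw [hk]; field_simp; linear_combination hγν
  have hmono := integral_mono_ae (iT.add (i4.const_mul k))
    ((iN.const_mul γ).add (iG.const_mul (δ ^ 2 * (C ^ 2 / ν)))) ?_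
  · have e1 := integral_add iT (i4.const_mul k)
    have e2 := integral_add (iN.const_mul γ) (iG.const_mul (δ ^ 2 * (C ^ 2 / ν)))
    rw [integral_const_mul] at e1
    rw [integral_const_mul, integral_const_mul] at e2
    simp only [Pi.add_apply] at hmono e1 e2
    rw [e1, e2, p4] at hmono
    linarith
  · filter_upwards [Measure.ae_ne volume (0 : R3)] with x hx
    have hr : 0 < ‖x‖ := norm_pos_iff.2 hx
    have hd := hasDerivAt_trialProfile (γ := γ) (ν := ν) (δ := δ)
      (hζ.differentiable (by simp)) hr
    simp only [Pi.add_apply]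
    rw [hφ, norm_sq_sigmaGrad_radialSpinor hx hd, inner_fderiv_radialSpinor hx hd,
      norm_radialSpinor, sq_abs]
    set r := ‖x‖
    set u := trialProfile ζ γ ν δ r
    set f := groundProfile γ ν r
    set z := deriv ζ (δ * Real.log r) with hz
    have hzC : z ^ 2 ≤ C ^ 2 := sq_le_sq' (by linarith [neg_abs_le z, hC (δ * Real.log r)])
      ((le_abs_self z).trans (hC _))
    set W := 1 + ν / r + γ with hW
    have hν' : 0 < ν / r := by positivity
    have hW0 : 0 < W := by linarith
    have hkW : (γ - 1) / r - ν = -(k * W) := by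
      rw [hW]; linear_combination hka + hkν * r⁻¹
    have hrem : (δ / r * z * f) ^ 2 / W ≤ δ ^ 2 * (C ^ 2 / ν) * (f ^ 2 / r) := by
      have h1 : (δ / r * z * f) ^ 2 / W ≤ (δ / r * z * f) ^ 2 / (ν / r) :=
        div_le_div_of_nonneg_left (by positivity) hν' (by linarith)
      refine h1.trans ?_
      have h2 : (δ / r * z * f) ^ 2 / (ν / r) = z ^ 2 * (δ ^ 2 * f ^ 2 / (ν * r)) := by
        field_simp
      have h3 : δ ^ 2 * (C ^ 2 / ν) * (f ^ 2 / r) = C ^ 2 * (δ ^ 2 * f ^ 2 / (ν * r)) := by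
        field_simp
      rw [h2, h3]
      exact mul_le_mul_of_nonneg_right hzC (by positivity)
    have hsq : (δ / r * z * f + ((γ - 1) / r - ν) * u) ^ 2 / W
        = (δ / r * z * f) ^ 2 / W - 2 * k * (δ / r * z * f) * u + k ^ 2 * W * u ^ 2 := by
      rw [hkW]; field_simp; ring
    rw [hsq]
    have hcross : k * (r⁻¹ * (2 * (r * (u * (δ / r * z * f + ((γ - 1) / r - ν) * u)))
        + 2 * u ^ 2)) = 2 * k * (δ / r * z * f) * u - 2 * k ^ 2 * W * u ^ 2
          + 2 * k * r⁻¹ * u ^ 2 := by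
      rw [hkW]; field_simp; ring
    rw [hcross]
    have hWk : k ^ 2 * W = 1 - γ + k * (1 - γ) * r⁻¹ := by
      rw [hW]; linear_combination k * hka + hkν + k * r⁻¹ * hkν
    have hvr : ν / r = k * (1 + γ) * r⁻¹ := by rw [hka, div_eq_mul_inv]
    have : k ^ 2 * W * u ^ 2 = (1 - γ + k * (1 - γ) * r⁻¹) * u ^ 2 := by rw [hWk]
    rw [hvr]
    linarith

end Trial

theorem integral_norm_sq_pos {φ : R3 → C2} (hφ : Continuous φ) (hs : HasCompactSupport φ)
    (h0 : φ ≠ 0) : 0 < ∫ x : R3, ‖φ x‖ ^ 2 := by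
  obtain ⟨x, hx⟩ := Function.ne_iff.1 h0
  refine (hφ.norm.pow 2).integral_pos_of_hasCompactSupport_nonneg_nonzero (x := x) ?_
    (fun x => by positivity) ?_
  · refine hs.mono fun x hx => ?_
    rw [Function.mem_support] at hx ⊢
    exact fun h => hx (by simp [h])
  · simpa using hx

theorem energy_antitone {φ : R3 → C2} {ν : ℝ} (hν : 0 < ν) (hφ : ContDiff ℝ 1 φ)
    (hs : HasCompactSupport φ) {l m : ℝ} (hl : -1 < l) (hlm : l ≤ m) :
    ∫ x : R3, (‖sigmaGrad φ x‖ ^ 2 / (1 + ν / ‖x‖ + m) + (1 - ν / ‖x‖) * ‖φ x‖ ^ 2) ≤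
      ∫ x : R3, (‖sigmaGrad φ x‖ ^ 2 / (1 + ν / ‖x‖ + l) + (1 - ν / ‖x‖) * ‖φ x‖ ^ 2) := by
  have hp := integrable_potential ν hφ.continuous hs
  refine integral_mono ((integrable_kinetic hν hφ hs (hl.trans_le hlm)).add hp)
    ((integrable_kinetic hν hφ hs hl).add hp) fun x => ?_
  simpa using kinetic_le hν hl hlm x

theorem energy_continuousOn {φ : R3 → C2} {ν : ℝ} (hν : 0 < ν) (hφ : ContDiff ℝ 1 φ)
    (hs : HasCompactSupport φ) {a : ℝ} (ha : -1 < a) :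
    ContinuousOn (fun l => ∫ x : R3, (‖sigmaGrad φ x‖ ^ 2 / (1 + ν / ‖x‖ + l)
      + (1 - ν / ‖x‖) * ‖φ x‖ ^ 2)) (Set.Ici a) := by
  have hp := integrable_potential ν hφ.continuous hs
  have hc : ContinuousOn (fun l => ∫ x : R3, ‖sigmaGrad φ x‖ ^ 2 / (1 + ν / ‖x‖ + l))
      (Set.Ici a) := by
    refine continuousOn_of_dominated (bound := fun x => ‖sigmaGrad φ x‖ ^ 2 / (1 + a))
      (fun l _ => aestronglyMeasurable_kinetic hφ l) ?_
      ((integrable_norm_sq_sigmaGrad hφ hs).div_const _) ?_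
    · intro l hl
      have hl : a ≤ l := hl
      refine Filter.Eventually.of_forall fun x => (kinetic_le_const hν (ha.trans_le hl) x).trans ?_
      exact div_le_div_of_nonneg_left (by positivity) (by linarith) (by linarith)
    · refine Filter.Eventually.of_forall fun x => ?_
      refine continuousOn_const.div (by fun_prop) fun l hl => ?_
      have hl : a ≤ l := hl
      have : 0 ≤ ν / ‖x‖ := by positivity
      linarith
  refine (hc.add (continuousOn_const (c := ∫ x : R3, (1 - ν / ‖x‖) * ‖φ x‖ ^ 2))).congr
    fun l hl => ?_
  exact integral_add (integrable_kinetic hν hφ hs (ha.trans_le hl)) hp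

theorem exists_trial {ν : ℝ} (hν : ν ∈ Set.Ioo (0 : ℝ) 1) {l : ℝ} (hl : √(1 - ν ^ 2) < l) :
    ∃ φ : R3 → C2, IsCc φ ∧ φ ≠ 0 ∧
      ∫ x : R3, (‖sigmaGrad φ x‖ ^ 2 / (1 + ν / ‖x‖ + l) + (1 - ν / ‖x‖) * ‖φ x‖ ^ 2)
        < l * ∫ x : R3, ‖φ x‖ ^ 2 := by
  obtain ⟨hν0, hν1⟩ := hν
  have hγν : √(1 - ν ^ 2) ^ 2 = 1 - ν ^ 2 := Real.sq_sqrt (by nlinarith)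
  have hγ : 0 < √(1 - ν ^ 2) := Real.sqrt_pos.2 (by nlinarith)
  set γ := √(1 - ν ^ 2)
  have hγ1 : γ < 1 := by nlinarith
  let ζ : ContDiffBump (0 : ℝ) := ⟨1, 2, one_pos, one_lt_two⟩
  have hζ : ContDiff ℝ (⊤ : ℕ∞) ζ := ζ.contDiff
  have hζ1 : ∀ t : ℝ, |t| ≤ 1 → ζ t = 1 := fun t ht =>
    ζ.one_of_mem_closedBall (by simpa using ht)
  have hζ2 : ∀ t : ℝ, 2 ≤ |t| → ζ t = 0 := fun t ht =>
    ζ.zero_of_le_dist (by simpa using ht)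
  obtain ⟨C, hC⟩ := (ζ.hasCompactSupport.deriv).exists_bound_of_continuous
    (hζ.continuous_deriv (by simp))
  simp only [Real.norm_eq_abs] at hC
  set K := C ^ 2 / ν * ∫ x : R3, groundProfile γ ν ‖x‖ ^ 2 / ‖x‖
  have hK : 0 ≤ K := mul_nonneg (by positivity) (integral_nonneg fun x => by positivity)
  have hcc : ∀ δ : ℝ, 0 < δ → IsCc (radialSpinor (trialProfile ζ γ ν δ)) :=
    fun δ hδ => isCc_trial hζ hζ2 hγ1.ne hδ
  have hne : ∀ δ : ℝ, radialSpinor (trialProfile ζ γ ν δ) ≠ 0 := by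
    intro δ h
    have h1 := congrFun h (EuclideanSpace.single 0 1)
    rw [Pi.zero_apply, ← norm_eq_zero, norm_radialSpinor] at h1
    simp [trialProfile, groundProfile, hζ1 0 (by simp)] at h1
  have hpos : ∀ δ : ℝ, 0 < δ → 0 < ∫ x : R3, ‖radialSpinor (trialProfile ζ γ ν δ) x‖ ^ 2 :=
    fun δ hδ => integral_norm_sq_pos (hcc δ hδ).1.continuous (hcc δ hδ).2 (hne δ)
  set M := ∫ x : R3, ‖radialSpinor (trialProfile ζ γ ν 2) x‖ ^ 2
  have hM : 0 < M := hpos 2 two_pos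
  have hmono : ∀ δ : ℝ, 0 < δ → δ ≤ 1 →
      M ≤ ∫ x : R3, ‖radialSpinor (trialProfile ζ γ ν δ) x‖ ^ 2 := by
    intro δ hδ hδ1
    refine integral_mono (integrable_norm_sq (hcc 2 two_pos).1.continuous (hcc 2 two_pos).2)
      (integrable_norm_sq (hcc δ hδ).1.continuous (hcc δ hδ).2) fun x => ?_
    simp only [norm_radialSpinor, sq_abs, trialProfile, mul_pow]
    refine mul_le_mul_of_nonneg_right ?_ (by positivity)
    rcases le_total 2 |2 * Real.log ‖x‖| with ht | ht
    · rw [hζ2 _ ht, zero_pow two_ne_zero]; positivity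
    · rw [abs_mul, abs_two] at ht
      have : |δ * Real.log ‖x‖| ≤ 1 := by
        rw [abs_mul, abs_of_pos hδ]
        nlinarith [abs_nonneg (Real.log ‖x‖)]
      rw [hζ1 _ this, one_pow]
      exact pow_le_one₀ ζ.nonneg ζ.le_one
  obtain ⟨δ, hδ, hδ1, hδK⟩ : ∃ δ : ℝ, 0 < δ ∧ δ ≤ 1 ∧ δ ^ 2 * K < (l - γ) * M := by
    have hlM : 0 < (l - γ) * M := mul_pos (by linarith) hM
    refine ⟨min 1 ((l - γ) * M / (K + 1)), lt_min one_pos (by positivity), min_le_left _ _, ?_⟩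
    set δ := min 1 ((l - γ) * M / (K + 1))
    have h0 : 0 < δ := lt_min one_pos (by positivity)
    have h1 : δ ≤ 1 := min_le_left _ _
    have h2 : δ * (K + 1) ≤ (l - γ) * M := (le_div_iff₀ (by positivity)).1 (min_le_right _ _)
    nlinarith [mul_nonneg (mul_nonneg h0.le (sub_nonneg.2 h1)) hK]
  refine ⟨_, hcc δ hδ, hne δ, ?_⟩
  have h1 := trial_energy_le hν0 hγ hγ1 hγν hζ hζ2 hC hδ rfl
  have h2 := energy_antitone hν0 ((hcc δ hδ).1.of_le (by exact_mod_cast le_top)) (hcc δ hδ).2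
    (by linarith : -1 < γ) hl.le
  have h3 := mul_le_mul_of_nonneg_left (hmono δ hδ hδ1) (sub_nonneg.2 hl.le)
  linarith

/-- For the Coulomb potential `-ν/|x|`, `0 < ν < 1`: each nonzero
`φ ∈ C_c^∞(ℝ³,ℂ²)` determines a unique level `λ(φ) ∈ (-1,∞)` solving the
nonlinear equation, and the infimum of `λ(φ)` over all such `φ` is `√(1-ν²)`. -/
theorem coulomb_level_inf (ν : ℝ) (hν : ν ∈ Set.Ioo (0 : ℝ) 1) :
    (∀ φ : R3 → C2, IsCc φ → φ ≠ 0 → ∃! lam : ℝ, -1 < lam ∧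
        lam * ∫ x : R3, ‖φ x‖ ^ 2 =
          ∫ x : R3, (‖sigmaGrad φ x‖ ^ 2 / (1 + ν / ‖x‖ + lam)
            + (1 - ν / ‖x‖) * ‖φ x‖ ^ 2))
    ∧ ∀ L : (R3 → C2) → ℝ,
        (∀ φ : R3 → C2, IsCc φ → φ ≠ 0 → -1 < L φ ∧
          L φ * ∫ x : R3, ‖φ x‖ ^ 2 =
            ∫ x : R3, (‖sigmaGrad φ x‖ ^ 2 / (1 + ν / ‖x‖ + L φ)
              + (1 - ν / ‖x‖) * ‖φ x‖ ^ 2)) →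
        (⨅ φ : {φ : R3 → C2 // IsCc φ ∧ φ ≠ 0}, ((L φ.1 : ℝ) : EReal))
          = ((Real.sqrt (1 - ν ^ 2) : ℝ) : EReal) := by
  obtain ⟨hν0, hν1⟩ := hν
  have hγ0 : 0 ≤ √(1 - ν ^ 2) := Real.sqrt_nonneg _
  have hC : ∀ {φ : R3 → C2}, IsCc φ → ContDiff ℝ 1 φ := fun h =>
    h.1.of_le (by exact_mod_cast le_top)
  have hardy : ∀ {φ : R3 → C2}, IsCc φ → _ := fun {φ} h =>
    coulomb_hardy (φ := φ) ⟨hν0, hν1⟩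
      (h.1.of_le (WithTop.coe_le_coe.2 (le_top : (2 : ℕ∞) ≤ ⊤))) h.2
  have hN : ∀ {φ : R3 → C2}, IsCc φ → φ ≠ 0 → 0 < ∫ x : R3, ‖φ x‖ ^ 2 := fun h h0 =>
    integral_norm_sq_pos h.1.continuous h.2 h0
  constructor
  · intro φ hφ h0
    have hNφ := hN hφ h0
    have hanti : ∀ {l m : ℝ}, -1 < l → l ≤ m → _ := fun hl hlm =>
      energy_antitone hν0 (hC hφ) hφ.2 hl hlm
    have hunique : ∀ {l m : ℝ}, -1 < l → l < m →
        l * ∫ x : R3, ‖φ x‖ ^ 2 =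
          ∫ x : R3, (‖sigmaGrad φ x‖ ^ 2 / (1 + ν / ‖x‖ + l)
            + (1 - ν / ‖x‖) * ‖φ x‖ ^ 2) →
        m * ∫ x : R3, ‖φ x‖ ^ 2 =
          ∫ x : R3, (‖sigmaGrad φ x‖ ^ 2 / (1 + ν / ‖x‖ + m)
            + (1 - ν / ‖x‖) * ‖φ x‖ ^ 2) → False := fun hl hlm el em => by
      have h1 := hanti hl hlm.le
      rw [← el, ← em] at h1
      exact (mul_lt_mul_of_pos_right hlm hNφ).not_ge h1
    have hγ1 : -1 < √(1 - ν ^ 2) := by linarith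
    have hcont := energy_continuousOn hν0 (hC hφ) hφ.2 hγ1
    have hlow := hardy hφ
    set G : ℝ → ℝ := fun l => ∫ x : R3, (‖sigmaGrad φ x‖ ^ 2 / (1 + ν / ‖x‖ + l)
      + (1 - ν / ‖x‖) * ‖φ x‖ ^ 2) with hG
    set γ := √(1 - ν ^ 2)
    set N := ∫ x : R3, ‖φ x‖ ^ 2
    have hγΛ : γ ≤ max γ (G γ / N) := le_max_left _ _
    have hup : G (max γ (G γ / N)) ≤ max γ (G γ / N) * N :=
      (hanti hγ1 hγΛ).trans ((div_le_iff₀ hNφ).1 (le_max_right _ _))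
    have hcont' : ContinuousOn (fun l => l * N - G l) (Set.Icc γ (max γ (G γ / N))) :=
      ContinuousOn.sub (by fun_prop) (hcont.mono Set.Icc_subset_Ici_self)
    obtain ⟨l, hl, hl0⟩ := intermediate_value_Icc hγΛ hcont'
      (show (0 : ℝ) ∈ Set.Icc _ _ from ⟨sub_nonpos.2 hlow, sub_nonneg.2 hup⟩)
    have hl1 : -1 < l := hγ1.trans_le hl.1
    have hle : l * N = G l := sub_eq_zero.1 hl0
    refine ⟨l, ⟨hl1, hle⟩, fun m hm => ?_⟩
    rcases lt_trichotomy m l with h | h | h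
    · exact (hunique hm.1 h hm.2 hle).elim
    · exact h
    · exact (hunique hl1 h hle hm.2).elim
  · intro L hL
    refine le_antisymm ?_ ?_
    · refine EReal.le_of_forall_lt_iff_le.1 fun l hl => ?_
      obtain ⟨φ, hφ, h0, hlt⟩ := exists_trial ⟨hν0, hν1⟩ (EReal.coe_lt_coe_iff.1 hl)
      refine (iInf_le _ ⟨φ, hφ, h0⟩).trans (EReal.coe_le_coe_iff.2 ?_)
      by_contra! hlL
      obtain ⟨h1, h2⟩ := hL φ hφ h0
      have hl1 : -1 < l := by linarith [EReal.coe_lt_coe_iff.1 hl]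
      have h3 := energy_antitone hν0 (hC hφ) hφ.2 hl1 hlL.le
      have h4 := mul_lt_mul_of_pos_right hlL (hN hφ h0)
      linarith
    · refine le_iInf fun ⟨φ, hφ, h0⟩ => EReal.coe_le_coe_iff.2 ?_
      by_contra! hlt
      obtain ⟨h1, h2⟩ := hL φ hφ h0
      have h3 := energy_antitone hν0 (hC hφ) hφ.2 h1 hlt.le
      have h4 := mul_lt_mul_of_pos_right hlt (hN hφ h0)
      have h5 := hardy hφ
      dsimp only at hlt h4
      linarith
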